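/- arXiv:2106.02312 — 3 statements merged into one kernel-verified Lean document; each statement's English description precedes it below -/
import Mathlib

section
/- Let A be a complete deterministic finite automaton over a finite alphabet with finite state set, transition graph Γ and transition semigroup S. Suppose S is aperiodic and for every idempotent e ∈ S the subsemigroup eSe is commutative and idempotent. Then for every C-node (p,q) of Γ² with p ⪰ q and for every s ∈ S: p·s ⪰ q if and only if q·s ⪰ q. -/
/-- Extended transition function of a DFA. -/
def deltaStar {Q A : Type*} (δ : Q → A → Q) (q : Q) (w : List A) : Q :=
  w.foldl δ q

/-- `p ⪰ q` : the state `q` is reachable from `p`. -/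
def Reach {Q A : Type*} (δ : Q → A → Q) (p q : Q) : Prop :=
  ∃ w : List A, deltaStar δ p w = q

/-- `(p, q)` is a C-node of `Γ²`: some nonempty word fixes both `p` and `q`. -/
def CNode {Q A : Type*} (δ : Q → A → Q) (p q : Q) : Prop :=
  ∃ w : List A, w ≠ [] ∧ deltaStar δ p w = p ∧ deltaStar δ q w = q

/-- The transition semigroup of a DFA: transformations of the state set
induced by nonempty words.  For `f` in the semigroup, `p·f = f p`, and the
semigroup product `f*g` is the composite `g ∘ f`. -/
def TransSemigroup {Q A : Type*} (δ : Q → A → Q) : Set (Q → Q) :=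
  {f | ∃ w : List A, w ≠ [] ∧ ∀ q, f q = deltaStar δ q w}

theorem deltaStar_append {Q A : Type*} (δ : Q → A → Q) (q : Q) (u v : List A) :
    deltaStar δ q (u ++ v) = deltaStar δ (deltaStar δ q u) v :=
  List.foldl_append

theorem Reach.trans {Q A : Type*} {δ : Q → A → Q} {p q r : Q}
    (hpq : Reach δ p q) (hqr : Reach δ q r) : Reach δ p r := by
  obtain ⟨u, rfl⟩ := hpq
  obtain ⟨v, rfl⟩ := hqr
  exact ⟨u ++ v, deltaStar_append δ p u v⟩

theorem reach_of_mem_transSemigroup {Q A : Type*} {δ : Q → A → Q} {f : Q → Q}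
    (hf : f ∈ TransSemigroup δ) (q : Q) : Reach δ q (f q) := by
  obtain ⟨w, -, hw⟩ := hf
  exact ⟨w, (hw q).symm⟩

theorem comp_mem_transSemigroup {Q A : Type*} {δ : Q → A → Q} {f g : Q → Q}
    (hf : f ∈ TransSemigroup δ) (hg : g ∈ TransSemigroup δ) :
    g ∘ f ∈ TransSemigroup δ := by
  obtain ⟨u, hu, hfu⟩ := hf
  obtain ⟨v, -, hgv⟩ := hg
  refine ⟨u ++ v, by simp [hu], fun q => ?_⟩
  rw [deltaStar_append, Function.comp_apply, hgv, hfu]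

theorem iterate_succ_mem_transSemigroup {Q A : Type*} {δ : Q → A → Q} {f : Q → Q}
    (hf : f ∈ TransSemigroup δ) (n : ℕ) : f^[n + 1] ∈ TransSemigroup δ := by
  induction n with
  | zero => exact hf
  | succ n ih =>
    rw [Function.iterate_succ]
    exact comp_mem_transSemigroup hf ih

theorem iterate_comp_self_of_iterate_eq_succ {α : Type*} {f : α → α} {n : ℕ}
    (h : f^[n] = f^[n + 1]) : f^[n] ∘ f^[n] = f^[n] := by
  have key : ∀ k, f^[n + k] = f^[n] := by
    intro k
    induction k with
    | zero => rfl
    | succ k ih => rw [← Nat.add_assoc, Function.iterate_succ', ih, ← Function.iterate_succ', ← h]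
  rw [← Function.iterate_add, key]

/-- If `S` is aperiodic, the two components of a C-node are fixed by a common idempotent of `S`. -/
theorem CNode.exists_idempotent {Q A : Type*} {δ : Q → A → Q}
    (haper : ∀ f ∈ TransSemigroup δ, ∃ n ≥ 1, f^[n] = f^[n + 1])
    {p q : Q} (h : CNode δ p q) :
    ∃ e ∈ TransSemigroup δ, e ∘ e = e ∧ e p = p ∧ e q = q := by
  obtain ⟨w, hw, hp, hq⟩ := h
  have hf : (fun x => deltaStar δ x w) ∈ TransSemigroup δ := ⟨w, hw, fun _ => rfl⟩
  obtain ⟨n, hn, hfn⟩ := haper _ hf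
  obtain ⟨m, rfl⟩ := Nat.exists_eq_add_of_le' hn
  exact ⟨_, iterate_succ_mem_transSemigroup hf m, iterate_comp_self_of_iterate_eq_succ hfn,
    Function.iterate_fixed hp _, Function.iterate_fixed hq _⟩

/-- Reaching a state from `f x` is witnessed by a transformation in `S` that factors through `f`. -/
theorem exists_mem_transSemigroup_of_reach {Q A : Type*} {δ : Q → A → Q} {f : Q → Q}
    (hf : f ∈ TransSemigroup δ) {x y : Q} (h : Reach δ (f x) y) :
    ∃ g ∈ TransSemigroup δ, g x = y ∧ ∀ z, Reach δ (f z) (g z) := by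
  obtain ⟨u, hu, hfu⟩ := hf
  obtain ⟨v, rfl⟩ := h
  refine ⟨fun z => deltaStar δ (f z) v, ⟨u ++ v, by simp [hu], fun z => ?_⟩, rfl,
    fun z => ⟨v, rfl⟩⟩
  rw [deltaStar_append, ← hfu]

/-- If the transition semigroup `S` is aperiodic and `eSe` is commutative and
idempotent for every idempotent `e ∈ S`, then for every C-node `(p,q)` of `Γ²`
with `p ⪰ q` and every `s ∈ S` : `p·s ⪰ q ↔ q·s ⪰ q`. -/
theorem cnode_reach_iff
    {Q A : Type*} [Fintype Q] [Fintype A] (δ : Q → A → Q)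
    (haper : ∀ f ∈ TransSemigroup δ, ∃ n ≥ 1, f^[n] = f^[n + 1])
    (hloc : ∀ e ∈ TransSemigroup δ, e ∘ e = e →
      ∀ s ∈ TransSemigroup δ,
        ((e ∘ s ∘ e) ∘ (e ∘ s ∘ e) = e ∘ s ∘ e ∧
          ∀ t ∈ TransSemigroup δ,
            (e ∘ s ∘ e) ∘ (e ∘ t ∘ e) = (e ∘ t ∘ e) ∘ (e ∘ s ∘ e))) :
    ∀ p q : Q, CNode δ p q → Reach δ p q →
      ∀ f ∈ TransSemigroup δ, (Reach δ (f p) q ↔ Reach δ (f q) q) := by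
  intro p q hC hpq f hf
  obtain ⟨e, he, hee, hep, heq⟩ := hC.exists_idempotent haper
  constructor
  · intro h
    obtain ⟨g, hg, hgp, hreach⟩ := exists_mem_transSemigroup_of_reach hf h
    have hidem := congrFun (hloc e he hee g hg).1 p
    simp only [Function.comp_apply, hep, hgp, heq] at hidem
    have hegq := reach_of_mem_transSemigroup he (g q)
    rw [hidem] at hegq
    exact (hreach q).trans hegq
  · intro h
    obtain ⟨g, hg, hgq, hreach⟩ := exists_mem_transSemigroup_of_reach hf h
    obtain ⟨r, hr, hrp, -⟩ := exists_mem_transSemigroup_of_reach he (hep.symm ▸ hpq)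
    have hcomm := congrFun ((hloc e he hee g hg).2 r hr) p
    simp only [Function.comp_apply, hep, hrp, heq, hgq] at hcomm
    have hback := reach_of_mem_transSemigroup (comp_mem_transSemigroup he
      (comp_mem_transSemigroup he (comp_mem_transSemigroup hr he))) (g p)
    simp only [Function.comp_apply, ← hcomm] at hback
    exact (hreach p).trans hback
end

section
/- A language L of nonempty words over a finite alphabet Σ is locally testable if and only if its syntactic semigroup S(L) is finite and, for every idempotent e ∈ S(L), the subsemigroup eS(L)e is commutative and idempotent. -/
/-- `L` is `k`-testable: membership of a nonempty word is determined by its prefix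
and suffix of length `k-1` and its set of factors of length `k`. -/
def KTestable {A : Type*} (L : Set (List A)) (k : ℕ) : Prop :=
  ∀ u v : List A, u ≠ [] → v ≠ [] →
    u.take (k - 1) = v.take (k - 1) →
    u.drop (u.length - (k - 1)) = v.drop (v.length - (k - 1)) →
    (∀ f : List A, f.length = k → (f <:+: u ↔ f <:+: v)) →
    (u ∈ L ↔ v ∈ L)

/-- `L` is locally testable: it is `k`-testable for some `k ≥ 1`. -/
def LocallyTestable {A : Type*} (L : Set (List A)) : Prop :=
  ∃ k ≥ 1, KTestable L k

/-- The syntactic congruence of `L` on the free semigroup of nonempty words: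
`u ~ v` iff `xuy ∈ L ↔ xvy ∈ L` for all (possibly empty) words `x, y`. -/
def synSetoid {A : Type*} (L : Set (List A)) : Setoid {w : List A // w ≠ []} where
  r u v := ∀ x y : List A, (x ++ u.1 ++ y ∈ L ↔ x ++ v.1 ++ y ∈ L)
  iseqv := ⟨fun _ _ _ => Iff.rfl, fun h x y => (h x y).symm,
    fun h1 h2 x y => (h1 x y).trans (h2 x y)⟩

/-- The syntactic semigroup of `L`: the quotient of the semigroup `Σ⁺` of
nonempty words by the syntactic congruence. -/
def SynSemigroup {A : Type*} (L : Set (List A)) : Type _ :=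
  Quotient (synSetoid L)

instance {A : Type*} (L : Set (List A)) : Semigroup (SynSemigroup L) where
  mul := Quotient.map₂ (fun u v => ⟨u.1 ++ v.1, by simp [u.2]⟩)
    (by
      intro u u' hu v v' hv x y
      have h1 := hu x (v.1 ++ y)
      have h2 := hv (x ++ u'.1) y
      simp only [List.append_assoc] at h1 h2 ⊢
      exact h1.trans h2)
  mul_assoc a b c := by
    induction a using Quotient.ind
    induction b using Quotient.ind
    induction c using Quotient.ind
    apply Quotient.sound
    intro x y
    simp [List.append_assoc]

section PathCongruence

variable {V A T : Type*} {δ : V → A → V}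

/-- The set of edges traversed when reading a word from a vertex of a deterministic graph. -/
def traversed (δ : V → A → V) : V → List A → Set (V × A)
  | _, [] => ∅
  | x, a :: u => insert (x, a) (traversed δ (δ x a) u)

@[simp] theorem traversed_nil (x : V) : traversed δ x [] = ∅ := rfl

@[simp] theorem traversed_cons (x : V) (a : A) (u : List A) :
    traversed δ x (a :: u) = insert (x, a) (traversed δ (δ x a) u) := rfl

@[simp] theorem traversed_append (x : V) (u v : List A) :
    traversed δ x (u ++ v) = traversed δ x u ∪ traversed δ (u.foldl δ x) v := by
  induction u generalizing x with
  | nil => simp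
  | cons a u ih => simp [ih, Set.insert_union]

theorem exists_split_of_mem_traversed {x : V} {u : List A} {e : V × A}
    (h : e ∈ traversed δ x u) :
    ∃ u₁ u₂, u = u₁ ++ e.2 :: u₂ ∧ u₁.foldl δ x = e.1 := by
  induction u generalizing x with
  | nil => simp at h
  | cons a u ih =>
    rcases h with rfl | h
    · exact ⟨[], u, rfl, rfl⟩
    · obtain ⟨u₁, u₂, rfl, h₂⟩ := ih h
      exact ⟨a :: u₁, u₂, rfl, h₂⟩

/-- `y` is connected to `z` by a path all of whose edges lie in `G`. -/
def ReachIn (δ : V → A → V) (G : Set (V × A)) (y z : V) : Prop :=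
  ∃ w : List A, w.foldl δ y = z ∧ traversed δ y w ⊆ G

theorem ReachIn.refl (G : Set (V × A)) (y : V) : ReachIn δ G y y := ⟨[], rfl, by simp⟩

theorem ReachIn.trans {G : Set (V × A)} {x y z : V} (h₁ : ReachIn δ G x y)
    (h₂ : ReachIn δ G y z) : ReachIn δ G x z := by
  obtain ⟨w, rfl, hw⟩ := h₁
  obtain ⟨w', rfl, hw'⟩ := h₂
  exact ⟨w ++ w', by simp, by simp [hw, hw']⟩

theorem ReachIn.head {G : Set (V × A)} {x z : V} {a : A} (ha : (x, a) ∈ G)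
    (h : ReachIn δ G (δ x a) z) : ReachIn δ G x z := by
  refine ReachIn.trans ⟨[a], rfl, ?_⟩ h
  simpa using ha

theorem reachIn_of_mem_traversed {x : V} {u : List A} {e : V × A}
    (h : e ∈ traversed δ x u) :
    ReachIn δ (traversed δ x u) x e.1 ∧
      ReachIn δ (traversed δ x u) (δ e.1 e.2) (u.foldl δ x) := by
  obtain ⟨u₁, u₂, rfl, h₂⟩ := exists_split_of_mem_traversed h
  refine ⟨⟨u₁, h₂, by rw [traversed_append]; exact Set.subset_union_left⟩, ⟨u₂, by simp [h₂], ?_⟩⟩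
  intro e' he'
  simp [h₂, he']

theorem ReachIn.mono {G H : Set (V × A)} (hGH : G ⊆ H) {x y : V} (h : ReachIn δ G x y) :
    ReachIn δ H x y := by
  obtain ⟨w, hw, hw'⟩ := h
  exact ⟨w, hw, hw'.trans hGH⟩

/-- If the edge `f` of the path `p₁ f p₂` lies on a cycle of the path's support through its
starting vertex, then `p₂` returns to a vertex of `p₁`. -/
theorem exists_common_vertex {x : V} {p₁ p₂ : List A} {f : A}
    (h : ReachIn δ (traversed δ x (p₁ ++ f :: p₂)) (δ (p₁.foldl δ x) f) x) :
    ∃ p₁₁ p₁₂ p₂₁ p₂₂, p₁ = p₁₁ ++ p₁₂ ∧ p₂ = p₂₁ ++ p₂₂ ∧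
      p₁₁.foldl δ x = p₂₁.foldl δ (δ (p₁.foldl δ x) f) := by
  set d := δ (p₁.foldl δ x) f with hd
  obtain ⟨w, hw, hwG⟩ := h
  suffices H : ∀ (w : List A) (y : V), (∃ p₂₁ p₂₂, p₂ = p₂₁ ++ p₂₂ ∧ p₂₁.foldl δ d = y) →
      w.foldl δ y = x → traversed δ y w ⊆ traversed δ x (p₁ ++ f :: p₂) →
      ∃ p₁₁ p₁₂ p₂₁ p₂₂, p₁ = p₁₁ ++ p₁₂ ∧ p₂ = p₂₁ ++ p₂₂ ∧ p₁₁.foldl δ x = p₂₁.foldl δ d from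
    H w d ⟨[], p₂, rfl, rfl⟩ hw hwG
  intro w
  induction w with
  | nil =>
    rintro y ⟨p₂₁, p₂₂, h₁, h₂⟩ hyx -
    exact ⟨[], p₁, p₂₁, p₂₂, rfl, h₁, by rw [h₂]; exact hyx.symm⟩
  | cons a w ih =>
    rintro y ⟨p₂₁, p₂₂, h₁, h₂⟩ hyx hG
    have hya : (y, a) ∈ traversed δ x (p₁ ++ f :: p₂) := hG (by simp)
    rw [traversed_append, traversed_cons] at hya
    rcases hya with hya | hya | hya
    · obtain ⟨u₁, u₂, h₃, h₄⟩ := exists_split_of_mem_traversed hya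
      exact ⟨u₁, _, p₂₁, p₂₂, h₃, h₁, h₄.trans h₂.symm⟩
    · have : y = p₁.foldl δ x := congrArg Prod.fst hya
      exact ⟨p₁, [], p₂₁, p₂₂, by simp, h₁, by rw [h₂, this]⟩
    · obtain ⟨u₁, u₂, h₃, h₄⟩ := exists_split_of_mem_traversed hya
      refine ih (δ y a) ⟨u₁ ++ [a], u₂, by simp [h₃], by simp [hd, h₄]⟩ hyx ?_
      exact fun e he => hG (by simp [he])

theorem exists_exit {P : V → Prop} {x : V} {p : List A} (hx : P x) (hp : ¬ P (p.foldl δ x)) :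
    ∃ p₁ f p₂, p = p₁ ++ f :: p₂ ∧ P (p₁.foldl δ x) ∧ ¬ P (δ (p₁.foldl δ x) f) := by
  induction p generalizing x with
  | nil => exact absurd hx hp
  | cons a p ih =>
    by_cases h : P (δ x a)
    · obtain ⟨p₁, f, p₂, rfl, h₁, h₂⟩ := ih h hp
      exact ⟨a :: p₁, f, p₂, rfl, h₁, h₂⟩
    · exact ⟨[], a, p, rfl, hx, h⟩

/-- An edge at which a path leaves the set of vertices from which its origin is reachable
separates the support of the path. -/
theorem exit_edge_spec {x : V} {p₁ p₂ : List A} {f : A} {G : Set (V × A)}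
    (hG : traversed δ x (p₁ ++ f :: p₂) = G)
    (h₁ : ReachIn δ G (p₁.foldl δ x) x) (h₂ : ¬ ReachIn δ G (δ (p₁.foldl δ x) f) x) :
    (∀ e, e ∈ traversed δ x p₁ ↔ e ∈ G ∧ ReachIn δ G (δ e.1 e.2) x) ∧
    (∀ e, e = (p₁.foldl δ x, f) ↔
      e ∈ G ∧ ReachIn δ G e.1 x ∧ ¬ ReachIn δ G (δ e.1 e.2) x) ∧
    (∀ e, e ∈ traversed δ (δ (p₁.foldl δ x) f) p₂ ↔ e ∈ G ∧ ¬ ReachIn δ G e.1 x) := by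
  have hmem : ∀ e, e ∈ G ↔ e ∈ traversed δ x p₁ ∨ e = (p₁.foldl δ x, f) ∨
      e ∈ traversed δ (δ (p₁.foldl δ x) f) p₂ := by
    intro e; rw [← hG, traversed_append, traversed_cons]; rfl
  have hleft : ∀ e ∈ traversed δ x p₁, ReachIn δ G (δ e.1 e.2) x := fun e he =>
    ((reachIn_of_mem_traversed he).2.mono fun e' he' => (hmem e').2 (.inl he')).trans h₁
  have hright : ∀ e ∈ traversed δ (δ (p₁.foldl δ x) f) p₂, ¬ ReachIn δ G e.1 x :=
    fun e he h => h₂ (((reachIn_of_mem_traversed he).1.mono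
      fun e' he' => (hmem e').2 (.inr (.inr he'))).trans h)
  have hback : ∀ e ∈ G, ReachIn δ G (δ e.1 e.2) x → ReachIn δ G e.1 x :=
    fun e he h => h.head he
  refine ⟨fun e => ?_, fun e => ?_, fun e => ?_⟩
  · refine ⟨fun he => ⟨(hmem e).2 (.inl he), hleft e he⟩, fun ⟨he, hr⟩ => ?_⟩
    rcases (hmem e).1 he with h | rfl | h
    · exact h
    · exact absurd hr h₂
    · exact absurd (hback e he hr) (hright e h)
  · refine ⟨?_, fun ⟨he, hr, hn⟩ => ?_⟩
    · rintro rfl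
      exact ⟨(hmem _).2 (.inr (.inl rfl)), h₁, h₂⟩
    · rcases (hmem e).1 he with h | h | h
      · exact absurd (hleft e h) hn
      · exact h
      · exact absurd hr (hright e h)
  · refine ⟨fun he => ⟨(hmem e).2 (.inr (.inr he)), hright e he⟩, fun ⟨he, hn⟩ => ?_⟩
    rcases (hmem e).1 he with h | rfl | h
    · exact absurd (hback e he (hleft e h)) hn
    · exact absurd h₁ hn
    · exact h

/-- A valuation of paths whose kernel is a congruence under which loops at a common vertex
are idempotent and commute. -/
structure LocallySemilattice (δ : V → A → V) (val : V → List A → T) : Prop where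
  right : ∀ {x u v} (w), u.foldl δ x = v.foldl δ x → val x u = val x v →
    val x (u ++ w) = val x (v ++ w)
  left : ∀ {x u v} (w), val (w.foldl δ x) u = val (w.foldl δ x) v →
    val x (w ++ u) = val x (w ++ v)
  idem : ∀ {x u}, u.foldl δ x = x → val x (u ++ u) = val x u
  comm : ∀ {x u v}, u.foldl δ x = x → v.foldl δ x = x → val x (u ++ v) = val x (v ++ u)

namespace LocallySemilattice

variable {val : V → List A → T}

theorem idem_mid (H : LocallySemilattice δ val) {x : V} (p : List A) {u : List A} (q : List A)
    (hu : u.foldl δ (p.foldl δ x) = p.foldl δ x) :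
    val x (p ++ (u ++ (u ++ q))) = val x (p ++ (u ++ q)) := by
  apply H.left
  rw [← List.append_assoc]
  exact H.right q (by simp [hu]) (H.idem hu)

theorem comm_mid (H : LocallySemilattice δ val) {x : V} (p : List A) {u v : List A} (q : List A)
    (hu : u.foldl δ (p.foldl δ x) = p.foldl δ x) (hv : v.foldl δ (p.foldl δ x) = p.foldl δ x) :
    val x (p ++ (u ++ (v ++ q))) = val x (p ++ (v ++ (u ++ q))) := by
  apply H.left
  rw [← List.append_assoc, ← List.append_assoc]
  exact H.right q (by simp [hu, hv]) (H.comm hu hv)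

theorem exists_detour (H : LocallySemilattice δ val) {x : V}
    (p r : List A) (hr : traversed δ x r ⊆ traversed δ x p)
    (hret : ReachIn δ (traversed δ x p) (r.foldl δ x) x) :
    ∃ s : List A, s.foldl δ (r.foldl δ x) = x ∧ val x p = val x (r ++ (s ++ p)) := by
  induction r using List.reverseRecOn with
  | nil => exact ⟨[], rfl, rfl⟩
  | append_singleton r f ih =>
    simp only [traversed_append, traversed_cons, traversed_nil, Set.union_subset_iff,
      List.foldl_append, List.foldl_cons, List.foldl_nil] at hr hret
    have hf : (r.foldl δ x, f) ∈ traversed δ x p := hr.2 (by simp)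
    obtain ⟨s, hs, hval⟩ := ih hr.1 (hret.head hf)
    obtain ⟨p₁, p₂, rfl, hc⟩ := exists_split_of_mem_traversed hf
    simp only at hc hret hval ⊢
    rw [← hc] at hret
    obtain ⟨p₁₁, p₁₂, p₂₁, p₂₂, rfl, rfl, hg⟩ := exists_common_vertex hret
    rw [hc] at hg
    have hc' : p₁₂.foldl δ (p₁₁.foldl δ x) = r.foldl δ x := by simpa using hc
    refine ⟨p₂₁ ++ (p₁₂ ++ s), ?_, ?_⟩
    · simp [← hg, hc', hs]
    · have h₁ := H.idem_mid (x := x) (r ++ (s ++ p₁₁)) (u := p₁₂ ++ f :: p₂₁) p₂₂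
        (by simp [hs, ← hg, hc'])
      have h₂ := H.comm_mid (x := x) r (u := s ++ (p₁₁ ++ p₁₂)) (v := f :: (p₂₁ ++ p₁₂))
        (f :: (p₂₁ ++ p₂₂)) (by simp [hs, hc']) (by simp [← hg, hc'])
      simp only [List.append_assoc, List.cons_append, List.nil_append] at h₁ h₂ hval ⊢
      rw [hval, ← h₁, h₂]

theorem loop_absorb (H : LocallySemilattice δ val) {x : V}
    (p r : List A) (hr : traversed δ x r ⊆ traversed δ x p)
    (hloop : r.foldl δ x = x) : val x (r ++ p) = val x p := by
  obtain ⟨s, hs, hval⟩ := H.exists_detour p r hr (by rw [hloop]; exact ReachIn.refl _ _)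
  rw [hloop] at hs
  have h₁ : val x (r ++ p) = val x (r ++ (r ++ (s ++ p))) :=
    H.left r (by rw [hloop]; exact hval)
  rw [h₁, hval]
  exact H.idem_mid [] _ hloop

theorem val_eq_of_reachIn (H : LocallySemilattice δ val) {x : V}
    {p q : List A} (hpq : p.foldl δ x = q.foldl δ x)
    (ht : traversed δ x p = traversed δ x q)
    (hret : ReachIn δ (traversed δ x p) (p.foldl δ x) x) : val x p = val x q := by
  obtain ⟨w, hw, hwG⟩ := hret
  have hw' : w.foldl δ (q.foldl δ x) = x := hpq ▸ hw
  have hp := H.loop_absorb p (q ++ w) (by rw [traversed_append, ← ht, ← hpq]; simp [hwG])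
    (by simp [hw'])
  have hq := H.loop_absorb q (p ++ w) (by rw [traversed_append, ← ht]; simp [hwG])
    (by simp [hw])
  have h₁ := H.right (w ++ q) (by simp [hw', hpq]) hp
  have h₂ := H.comm_mid q (u := w ++ p) (v := w ++ q) [] (x := x)
    (by simp [hw', hpq]) (by simp [hw'])
  have h₃ := H.idem_mid [] (x := x) (u := q ++ w) p (by simp [hw'])
  simp only [List.append_assoc, List.append_nil, List.nil_append] at hp hq h₁ h₂ h₃
  rw [← hq, ← h₁, h₂, h₃, hp]

/-- Simon's theorem: coterminal paths with the same support have the same value. -/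
theorem val_eq_of_traversed_eq (H : LocallySemilattice δ val) {x : V}
    {p q : List A} (hpq : p.foldl δ x = q.foldl δ x)
    (ht : traversed δ x p = traversed δ x q) : val x p = val x q := by
  induction hn : p.length using Nat.strong_induction_on generalizing x p q with
  | _ n ih =>
    by_cases hret : ReachIn δ (traversed δ x p) (p.foldl δ x) x
    · exact H.val_eq_of_reachIn hpq ht hret
    obtain ⟨p₁, f, p₂, rfl, hp₁, hp₂⟩ :=
      exists_exit (P := fun y => ReachIn δ (traversed δ x p) y x) (ReachIn.refl _ _) hret
    generalize hG : traversed δ x (p₁ ++ f :: p₂) = G at *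
    obtain ⟨q₁, g, q₂, rfl, hq₁, hq₂⟩ :=
      exists_exit (P := fun y => ReachIn δ G y x) (ReachIn.refl _ _) (hpq ▸ hret)
    obtain ⟨hpl, hpm, hpr⟩ := exit_edge_spec hG hp₁ hp₂
    obtain ⟨hql, hqm, hqr⟩ := exit_edge_spec ht.symm hq₁ hq₂
    have hedge : (p₁.foldl δ x, f) = (q₁.foldl δ x, g) := (hqm _).2 ((hpm _).1 rfl)
    obtain ⟨hc, rfl⟩ := Prod.mk.inj hedge
    have hleft : val x p₁ = val x q₁ := by
      refine H.val_eq_of_reachIn hc (Set.ext fun e => (hpl e).trans (hql e).symm) ?_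
      obtain ⟨w, hw, hwG⟩ := hp₁
      refine ⟨w, hw, fun e he => (hpl e).2 ⟨hwG he, ?_⟩⟩
      have := (reachIn_of_mem_traversed he).2.mono hwG
      rwa [hw] at this
    have hright : val (δ (q₁.foldl δ x) f) p₂ = val (δ (q₁.foldl δ x) f) q₂ := by
      refine ih p₂.length ?_ ?_ ?_ rfl
      · rw [← hn]; simp; omega
      · simpa [hc] using hpq
      · rw [← hc]; ext e; rw [hpr e, hc]; exact (hqr e).symm
    rw [H.right (f :: p₂) hc hleft]
    have := H.left (x := x) (q₁ ++ [f]) (u := p₂) (v := q₂) (by simpa using hright)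
    simpa using this

end LocallySemilattice

end PathCongruence

section Words

variable {A : Type*}

theorem infix_append_append {k : ℕ} {f u m v : List A} (hf : f.length = k) (hm : k ≤ m.length) :
    f <:+: u ++ m ++ v ↔ f <:+: u ++ m ∨ f <:+: m ++ v := by
  constructor
  · rintro ⟨s, t, h⟩
    rw [List.append_assoc u, List.append_assoc s] at h
    rcases List.append_eq_append_iff.1 h with ⟨a, rfl, h'⟩ | ⟨a, rfl, h'⟩
    · left
      rw [← List.append_assoc] at h'
      rcases List.append_eq_append_iff.1 h' with ⟨b, h₁, -⟩ | ⟨b, h₁, -⟩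
      · exact ⟨s, b, by simp [h₁]⟩
      · have := congrArg List.length h₁
        simp only [List.length_append] at this
        have hb : b = [] := List.length_eq_zero_iff.1 (by omega)
        subst hb
        exact ⟨s, [], by simp [h₁]⟩
    · right
      exact ⟨a, t, by simp [h']⟩
  · rintro (h | h)
    · exact h.trans (List.prefix_append _ _).isInfix
    · rw [List.append_assoc]
      exact h.trans (List.suffix_append _ _).isInfix

/-- `u` and `v` have the same prefix and suffix of length `k - 1` and the same factors of
length `k`. -/
def SameTests (k : ℕ) (u v : List A) : Prop :=
  u.take (k - 1) = v.take (k - 1) ∧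
    u.drop (u.length - (k - 1)) = v.drop (v.length - (k - 1)) ∧
    ∀ f : List A, f.length = k → (f <:+: u ↔ f <:+: v)

namespace SameTests

variable {k : ℕ} {u v : List A}

theorem reverse (h : SameTests k u v) : SameTests k u.reverse v.reverse := by
  refine ⟨?_, ?_, fun f hf => ?_⟩
  · rw [List.take_reverse, List.take_reverse, h.2.1]
  · simp only [List.drop_reverse, List.length_reverse]
    have key : ∀ w : List A, w.take (w.length - (w.length - (k - 1))) = w.take (k - 1) := by
      intro w
      rcases le_total w.length (k - 1) with hw | hw
      · rw [List.take_of_length_le (by omega), List.take_of_length_le hw]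
      · congr 1; omega
    rw [key, key, h.1]
  · rw [← List.reverse_infix, List.reverse_reverse, ← List.reverse_infix (l₂ := v.reverse),
      List.reverse_reverse]
    exact h.2.2 _ (by simpa using hf)

theorem eq_of_length_lt (h : SameTests k u v) (hu : u.length < k - 1) : u = v := by
  have h₁ := h.1
  have := congrArg List.length h₁
  simp only [List.length_take] at this
  rwa [List.take_of_length_le (by omega), List.take_of_length_le (by omega)] at h₁

theorem symm (h : SameTests k u v) : SameTests k v u :=
  ⟨h.1.symm, h.2.1.symm, fun f hf => (h.2.2 f hf).symm⟩

theorem cons (hk : 1 ≤ k) (h : SameTests k u v) (a : A) : SameTests k (a :: u) (a :: v) := by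
  by_cases hu : u.length < k - 1
  · rw [h.eq_of_length_lt hu]; exact ⟨rfl, rfl, fun _ _ => Iff.rfl⟩
  by_cases hv : v.length < k - 1
  · rw [h.symm.eq_of_length_lt hv]; exact ⟨rfl, rfl, fun _ _ => Iff.rfl⟩
  obtain ⟨j, rfl⟩ : ∃ j, k = j + 1 := ⟨k - 1, by omega⟩
  obtain ⟨h₁, h₂, h₃⟩ := h
  rw [Nat.add_sub_cancel] at h₁ h₂ hu hv
  refine ⟨?_, ?_, fun f hf => ?_⟩
  · rw [Nat.add_sub_cancel]
    cases j with
    | zero => rfl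
    | succ j =>
      have := congrArg (List.take j) h₁
      simp only [List.take_take] at this
      simpa using this
  · rw [Nat.add_sub_cancel, List.length_cons, List.length_cons, Nat.sub_add_comm (not_lt.1 hu),
      Nat.sub_add_comm (not_lt.1 hv), List.drop_succ_cons, List.drop_succ_cons, h₂]
  · rw [List.infix_cons_iff, List.infix_cons_iff, h₃ f hf, List.prefix_iff_eq_take,
      List.prefix_iff_eq_take, hf]
    simp [h₁]

theorem append_left (hk : 1 ≤ k) (h : SameTests k u v) (x : List A) :
    SameTests k (x ++ u) (x ++ v) := by
  induction x with
  | nil => exact h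
  | cons a x ih => exact ih.cons hk a

theorem append_right (hk : 1 ≤ k) (h : SameTests k u v) (x : List A) :
    SameTests k (u ++ x) (v ++ x) := by
  simpa using (h.reverse.append_left hk x.reverse).reverse

theorem of_factors {e s t : List A} (he : k ≤ e.length)
    (h : ∀ f : List A, f.length = k → (f <:+: e ++ s ++ e ↔ f <:+: e ++ t ++ e)) :
    SameTests k (e ++ s ++ e) (e ++ t ++ e) := by
  refine ⟨?_, ?_, h⟩
  · rw [List.append_assoc, List.append_assoc, List.take_append_of_le_length (by omega),
      List.take_append_of_le_length (by omega)]
  · have key : ∀ w : List A, (w ++ e).drop ((w ++ e).length - (k - 1)) =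
        e.drop (e.length - (k - 1)) := by
      intro w
      rw [List.drop_append, List.drop_eq_nil_of_le (by simp; omega)]
      simp only [List.nil_append, List.length_append]
      congr 1; omega
    rw [key, key]

end SameTests

/-- The syntactic class of a nonempty word. -/
def synClass (L : Set (List A)) (u : List A) (hu : u ≠ []) : SynSemigroup L :=
  Quotient.mk (synSetoid L) ⟨u, hu⟩

/-- The set of contexts of `u` with respect to `L`. -/
def contexts (L : Set (List A)) (u : List A) : Set (List A × List A) :=
  {c | c.1 ++ u ++ c.2 ∈ L}

variable {L : Set (List A)}

theorem synClass_eq_iff {u v : List A} {hu : u ≠ []} {hv : v ≠ []} :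
    synClass L u hu = synClass L v hv ↔ contexts L u = contexts L v := by
  refine Quotient.eq.trans ⟨fun h => ?_, fun h x y => ?_⟩
  · ext ⟨x, y⟩; exact h x y
  · exact Set.ext_iff.1 h (x, y)

theorem synClass_mul {u v : List A} (hu : u ≠ []) (hv : v ≠ []) :
    synClass L u hu * synClass L v hv = synClass L (u ++ v) (by simp [hu]) := rfl

theorem exists_synClass (s : SynSemigroup L) : ∃ u hu, s = synClass L u hu := by
  induction s using Quotient.ind with
  | _ u => exact ⟨u.1, u.2, rfl⟩

theorem contexts_congr {u v : List A} (h : contexts L u = contexts L v) (x y : List A) :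
    contexts L (x ++ u ++ y) = contexts L (x ++ v ++ y) := by
  ext ⟨a, b⟩
  have := Set.ext_iff.1 h (a ++ x, y ++ b)
  simpa [contexts] using this

theorem KTestable.synClass_eq {k : ℕ} (hk : 1 ≤ k) (h : KTestable L k) {u v : List A}
    {hu : u ≠ []} {hv : v ≠ []} (huv : SameTests k u v) : synClass L u hu = synClass L v hv := by
  rw [synClass_eq_iff]
  ext ⟨x, y⟩
  obtain ⟨h₁, h₂, h₃⟩ := (huv.append_left hk x).append_right hk y
  exact h _ _ (by simp [hu]) (by simp [hv]) h₁ h₂ h₃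

theorem KTestable.finite_synSemigroup [Finite A] {k : ℕ} (hk : 1 ≤ k) (h : KTestable L k) :
    Finite (SynSemigroup L) := by
  have : Finite {l : List A // l.length < k} := List.finite_length_lt A k
  have : Finite {l : List A // l.length = k} := List.finite_length_eq A k
  refine Finite.of_injective (β := {l : List A // l.length < k} × {l : List A // l.length < k} ×
    Set {l : List A // l.length = k}) (fun s =>
      (⟨(Quotient.out s).1.take (k - 1), by simp; omega⟩,
       ⟨(Quotient.out s).1.drop ((Quotient.out s).1.length - (k - 1)), by simp; omega⟩,
       {f | f.1 <:+: (Quotient.out s).1})) ?_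
  intro s t hst
  simp only [Prod.mk.injEq, Subtype.mk.injEq] at hst
  obtain ⟨h₁, h₂, h₃⟩ := hst
  have := h.synClass_eq hk (hu := (Quotient.out s).2) (hv := (Quotient.out t).2)
    ⟨h₁, h₂, fun f hf => Set.ext_iff.1 h₃ ⟨f, hf⟩⟩
  have key : ∀ s : SynSemigroup L, synClass L (Quotient.out s).1 (Quotient.out s).2 = s :=
    fun s => Quotient.out_eq s
  rwa [key, key] at this

theorem exists_long_synClass {e : SynSemigroup L} (he : e * e = e) (k : ℕ) :
    ∃ u hu, e = synClass L u hu ∧ k ≤ u.length := by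
  induction k with
  | zero => obtain ⟨u, hu, h⟩ := exists_synClass e; exact ⟨u, hu, h, Nat.zero_le _⟩
  | succ k ih =>
    obtain ⟨u, hu, h, hl⟩ := ih
    refine ⟨u ++ u, by simp [hu], ?_, ?_⟩
    · rw [← synClass_mul hu hu, ← h, he]
    · have := List.length_pos_iff.2 hu
      simp; omega

theorem KTestable.locally_semilattice {k : ℕ} (hk : 1 ≤ k) (h : KTestable L k)
    {e : SynSemigroup L} (he : e * e = e) (s t : SynSemigroup L) :
    (e * s * e) * (e * s * e) = e * s * e ∧
      (e * s * e) * (e * t * e) = (e * t * e) * (e * s * e) := by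
  have hee : ∀ s t : SynSemigroup L, (e * s * e) * (e * t * e) = e * (s * e * t) * e := by
    intro s t
    calc (e * s * e) * (e * t * e) = e * s * (e * e) * t * e := by simp only [mul_assoc]
      _ = _ := by rw [he]; simp only [mul_assoc]
  rw [hee, hee, hee]
  obtain ⟨w, hw, rfl, hl⟩ := exists_long_synClass he k
  obtain ⟨u, hu, rfl⟩ := exists_synClass s
  obtain ⟨v, hv, rfl⟩ := exists_synClass t
  have key : ∀ (a b f : List A), f.length = k → (f <:+: w ++ (a ++ w ++ b) ++ w ↔
      f <:+: w ++ a ++ w ∨ f <:+: w ++ b ++ w) := by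
    intro a b f hf
    have := infix_append_append (u := w ++ a) (v := b ++ w) hf hl
    simpa only [List.append_assoc] using this
  simp only [synClass_mul]
  constructor
  · exact h.synClass_eq hk (SameTests.of_factors hl fun f hf => by rw [key _ _ _ hf, or_self])
  · exact h.synClass_eq hk (SameTests.of_factors hl fun f hf => by
      rw [key _ _ _ hf, key _ _ _ hf, or_comm])

/-- The de Bruijn graph: reading a letter shifts a window of length `n`. -/
def shift (n : ℕ) (x : {w : List A // w.length = n}) (a : A) : {w : List A // w.length = n} :=
  ⟨(x.1 ++ [a]).drop 1, by simp [x.2]⟩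

theorem foldl_shift {n : ℕ} (x : {w : List A // w.length = n}) (u : List A) :
    (u.foldl (shift n) x).1 = (x.1 ++ u).drop u.length := by
  induction u generalizing x with
  | nil => simp
  | cons a u ih =>
    rw [List.foldl_cons, ih, shift, List.length_cons, Nat.add_comm, ← List.drop_drop]
    simp only
    congr 1
    rcases x with ⟨_ | ⟨b, x⟩, hx⟩ <;> simp

theorem exists_append_eq_append_foldl_shift {n : ℕ} (x : {w : List A // w.length = n})
    (u : List A) : ∃ t, x.1 ++ u = t ++ (u.foldl (shift n) x).1 :=
  ⟨(x.1 ++ u).take u.length, by rw [foldl_shift, List.take_append_drop]⟩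

theorem mem_traversed_shift {n : ℕ} (hn : 1 ≤ n) (x : {w : List A // w.length = n}) (u : List A)
    (e : {w : List A // w.length = n} × A) :
    e ∈ traversed (shift n) x u ↔ e.1.1 ++ [e.2] <:+: x.1 ++ u := by
  induction u generalizing x with
  | nil =>
    simp only [traversed_nil, Set.mem_empty_iff_false, List.append_nil, false_iff]
    intro h
    have := h.length_le
    simp [x.2, e.1.2] at this
  | cons a u ih =>
    rw [traversed_cons, Set.mem_insert_iff, ih]
    obtain ⟨⟨y, hy⟩, c⟩ := e
    obtain ⟨_ | ⟨b, x⟩, hx⟩ := x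
    · simp at hx; omega
    · simp only [shift, List.cons_append, List.drop_succ_cons, List.drop_zero, List.append_assoc,
        List.nil_append, Prod.mk.injEq, Subtype.mk.injEq]
      rw [List.infix_cons_iff]
      refine or_congr ?_ Iff.rfl
      have hpre : b :: (x ++ a :: u) = (b :: x ++ [a]) ++ u := by simp
      rw [hpre, List.prefix_iff_eq_take, List.take_append_of_le_length (by simp at hx ⊢; omega),
        List.take_of_length_le (by simp at hx ⊢; omega)]
      constructor
      · rintro ⟨rfl, rfl⟩; rfl
      · intro h
        have := List.append_inj' h rfl
        exact ⟨this.1, by simpa using this.2⟩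

theorem exists_idempotent_stabilizer [Finite (SynSemigroup L)] {p q : List A} (hq : q ≠ [])
    (h : contexts L (p ++ q) = contexts L p) :
    ∃ w : List A, w ≠ [] ∧ contexts L (w ++ w) = contexts L w ∧
      contexts L (p ++ w) = contexts L p := by
  let S : Set (SynSemigroup L) := {s | ∃ w hw, s = synClass L w hw ∧
    contexts L (p ++ w) = contexts L p}
  let _ : TopologicalSpace (SynSemigroup L) := ⊥
  have _ : DiscreteTopology (SynSemigroup L) := ⟨rfl⟩
  obtain ⟨e, ⟨w, hw, rfl, hpw⟩, he⟩ := exists_idempotent_in_compact_subsemigroup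
    (fun r => continuous_of_discreteTopology) S ⟨_, q, hq, rfl, h⟩ (Set.toFinite S).isCompact (by
      rintro _ ⟨u, hu, rfl, hu'⟩ _ ⟨v, hv, rfl, hv'⟩
      refine ⟨u ++ v, by simp [hu], rfl, ?_⟩
      have := contexts_congr hu' [] v
      simp only [List.nil_append, List.append_assoc] at this
      rw [this, hv'])
  rw [synClass_mul, synClass_eq_iff] at he
  exact ⟨w, hw, he, hpw⟩

/-- A long word has a prefix that is stabilised on the right by an idempotent. -/
theorem exists_prefix_stabilized [Finite (SynSemigroup L)] {x : List A}
    (hx : Nat.card (SynSemigroup L) < x.length) :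
    ∃ p y w : List A, x = p ++ y ∧ w ≠ [] ∧ contexts L (w ++ w) = contexts L w ∧
      contexts L (p ++ w) = contexts L p := by
  have := Fintype.ofFinite (SynSemigroup L)
  rw [Nat.card_eq_fintype_card] at hx
  have hne : ∀ i : Fin x.length, x.take (i + 1) ≠ [] := by
    intro i h
    have := i.pos
    simp_all
  obtain ⟨i, j, hij, heq⟩ := Fintype.exists_ne_map_eq_of_card_lt
    (fun i : Fin x.length => synClass L (x.take (i + 1)) (hne i)) (by simpa using hx)
  wlog hlt : i < j generalizing i j
  · exact this j i hij.symm heq.symm (lt_of_le_of_ne (not_lt.1 hlt) hij.symm)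
  rw [synClass_eq_iff] at heq
  have hlt' : (i : ℕ) < j := hlt
  have hsplit : x.take (j + 1) = x.take (i + 1) ++ (x.take (j + 1)).drop (i + 1) := by
    conv_lhs => rw [← List.take_append_drop (i + 1) (x.take (j + 1)), List.take_take,
      min_eq_left (by omega)]
  rw [hsplit] at heq
  obtain ⟨w, h₁, h₂, h₃⟩ := exists_idempotent_stabilizer (p := x.take (i + 1)) (by
    intro h
    have := congrArg List.length h
    have := j.2
    simp at *
    omega) heq.symm
  exact ⟨_, _, w, (List.take_append_drop (i + 1) x).symm, h₁, h₂, h₃⟩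

/-- If `x u` ends in `x = p y`, then `u` and its action on `p` have conjugates `z` and `t`. -/
theorem exists_conjugate {p y u t : List A} (h : p ++ y ++ u = t ++ (p ++ y)) :
    ∃ z : List A, y ++ u = z ++ y ∧ p ++ z = t ++ p := by
  obtain ⟨z, hz⟩ : p <+: t ++ p := by
    refine List.prefix_of_prefix_length_le (l₃ := p ++ y ++ u) ?_ ?_ (by simp)
    · rw [List.append_assoc]; exact List.prefix_append _ _
    · rw [h, ← List.append_assoc]; exact List.prefix_append _ _
  refine ⟨z, ?_, hz⟩
  rw [← List.append_assoc, ← hz] at h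
  simpa using h

theorem contexts_stabilized {p w z t : List A} (hw : contexts L (p ++ w) = contexts L p)
    (hz : p ++ z = t ++ p) : contexts L (p ++ (w ++ z ++ w)) = contexts L (t ++ p) := by
  have h₁ := contexts_congr hw [] (z ++ w)
  have h₂ := contexts_congr hw t []
  simp only [List.nil_append, List.append_nil, List.append_assoc] at h₁ h₂ ⊢
  rw [h₁, ← List.append_assoc p, hz, List.append_assoc, h₂]

theorem locallySemilattice_shift [Finite (SynSemigroup L)]
    (hS : ∀ e : SynSemigroup L, e * e = e → ∀ s t : SynSemigroup L,
      (e * s * e) * (e * s * e) = e * s * e ∧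
      (e * s * e) * (e * t * e) = (e * t * e) * (e * s * e)) {n : ℕ}
    (hn : Nat.card (SynSemigroup L) < n) :
    LocallySemilattice (shift n) fun x (u : List A) => contexts L (x.1 ++ u) := by
  have hloop : ∀ x : {w : List A // w.length = n}, ∃ p y w : List A, x.1 = p ++ y ∧
      contexts L (p ++ w) = contexts L p ∧
      (∀ r s : List A, contexts L (w ++ r ++ w ++ (w ++ r ++ w)) = contexts L (w ++ r ++ w) ∧
        contexts L (w ++ r ++ w ++ (w ++ s ++ w)) = contexts L (w ++ s ++ w ++ (w ++ r ++ w))) ∧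
      ∀ u : List A, u.foldl (shift n) x = x →
        ∃ z t : List A, y ++ u = z ++ y ∧ p ++ z = t ++ p := by
    intro x
    obtain ⟨p, y, w, hx, hw, hww, hpw⟩ := exists_prefix_stabilized (L := L) (x.2 ▸ hn)
    refine ⟨p, y, w, hx, hpw, fun r s => ?_, fun u hu => ?_⟩
    · have h := hS (synClass L w hw) (by rw [synClass_mul, synClass_eq_iff, hww])
        (synClass L (w ++ r) (by simp [hw])) (synClass L (w ++ s) (by simp [hw]))
      simp only [synClass_mul, synClass_eq_iff] at h
      have e₁ : ∀ r c d, contexts L (c ++ (w ++ (w ++ r) ++ w) ++ d) =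
          contexts L (c ++ (w ++ r ++ w) ++ d) := by
        intro r c d
        have := contexts_congr hww c (r ++ w ++ d)
        simpa only [List.append_assoc] using this
      have e₂ : ∀ r s, contexts L (w ++ (w ++ r) ++ w ++ (w ++ (w ++ s) ++ w)) =
          contexts L (w ++ r ++ w ++ (w ++ s ++ w)) := by
        intro r s
        have h₁ := e₁ r [] (w ++ (w ++ s) ++ w)
        have h₂ := e₁ s (w ++ r ++ w) []
        rw [List.append_nil, List.append_nil] at h₂
        exact h₁.trans h₂
      have e₃ := e₁ r [] []
      simp only [List.nil_append, List.append_nil] at e₃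
      rw [e₂, e₂, e₂, e₃] at h
      exact h
    · obtain ⟨t, ht⟩ := exists_append_eq_append_foldl_shift x u
      rw [hu, hx] at ht
      obtain ⟨z, h₁, h₂⟩ := exists_conjugate ht
      exact ⟨z, t, h₁, h₂⟩
  have hmul : ∀ {p y w u v z z' t t' : List A}, contexts L (p ++ w) = contexts L p →
      y ++ u = z ++ y → p ++ z = t ++ p → y ++ v = z' ++ y → p ++ z' = t' ++ p →
      contexts L (p ++ y ++ (u ++ v)) =
        contexts L (p ++ (w ++ z ++ w ++ (w ++ z' ++ w)) ++ y) := by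
    intro p y w u v z z' t t' hw hu hz hv hz'
    have h₁ := contexts_congr (contexts_stabilized hw hz) [] (w ++ z' ++ w ++ y)
    have h₂ := contexts_congr (contexts_stabilized hw hz') t y
    have h₃ : p ++ y ++ (u ++ v) = t ++ (t' ++ p) ++ y := by
      rw [← hz', ← List.append_assoc t, ← hz, List.append_assoc p y, ← List.append_assoc y, hu,
        List.append_assoc z, hv]
      simp only [List.append_assoc]
    rw [h₃, ← h₂]
    simp only [List.nil_append, List.append_assoc] at h₁ ⊢
    exact h₁.symm
  refine ⟨fun {x u v} w _ h => ?_, fun {x u v} w h => ?_, fun {x u} hu => ?_,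
    fun {x u v} hu hv => ?_⟩
  · simpa using contexts_congr h [] w
  · obtain ⟨t, ht⟩ := exists_append_eq_append_foldl_shift x w
    have := contexts_congr h t []
    simp only [List.append_nil, ← List.append_assoc, ← ht] at this
    simpa using this
  · obtain ⟨p, y, w, hx, hpw, hw, hz⟩ := hloop x
    obtain ⟨z, t, h₁, h₂⟩ := hz u hu
    simp only [hx]
    rw [hmul hpw h₁ h₂ h₁ h₂, contexts_congr (hw z z).1 p y, List.append_assoc p y, h₁,
      ← List.append_assoc p z, h₂]
    simpa using contexts_congr (contexts_stabilized hpw h₂) [] y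
  · obtain ⟨p, y, w, hx, hpw, hw, hz⟩ := hloop x
    obtain ⟨z, t, h₁, h₂⟩ := hz u hu
    obtain ⟨z', t', h₁', h₂'⟩ := hz v hv
    simp only [hx]
    rw [hmul hpw h₁ h₂ h₁' h₂', contexts_congr (hw z z').2 p y, hmul hpw h₁' h₂' h₁ h₂]

theorem length_le_of_factors {n : ℕ} {u v : List A} (hu : u.length ≤ n)
    (h : ∀ f : List A, f.length = n + 1 → (f <:+: u ↔ f <:+: v)) : v.length ≤ n := by
  by_contra! hv
  have hl : (v.take (n + 1)).length = n + 1 := by simp; omega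
  have := ((h _ hl).2 (List.take_prefix _ _).isInfix).length_le
  omega

theorem LocallySemilattice.kTestable {n : ℕ} (hn : 1 ≤ n)
    (H : LocallySemilattice (shift n) fun x (u : List A) => contexts L (x.1 ++ u)) :
    KTestable L (n + 1) := by
  intro u v _ _ hpre hsuf hfac
  rw [Nat.add_sub_cancel] at hpre hsuf
  by_cases hu : u.length ≤ n
  · have hv := length_le_of_factors hu hfac
    rw [List.take_of_length_le hu, List.take_of_length_le hv] at hpre
    rw [hpre]
  have hv : ¬ v.length ≤ n := fun hv =>
    hu (length_le_of_factors hv fun f hf => (hfac f hf).symm)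
  have key : contexts L u = contexts L v := by
    let x : {w : List A // w.length = n} := ⟨u.take n, by simp; omega⟩
    have hux : x.1 ++ u.drop n = u := List.take_append_drop n u
    have hvx : x.1 ++ v.drop n = v := by
      simp only [x, hpre]; exact List.take_append_drop n v
    have := H.val_eq_of_traversed_eq (x := x) (p := u.drop n) (q := v.drop n) ?_ ?_
    · simpa only [hux, hvx] using this
    · apply Subtype.ext
      rw [foldl_shift, foldl_shift, hux, hvx, List.length_drop, List.length_drop, hsuf]
    · ext e
      rw [mem_traversed_shift hn, mem_traversed_shift hn, hux, hvx]
      exact hfac _ (by simp [e.1.2])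
  simpa [contexts] using Set.ext_iff.1 key ([], [])

end Words

/-- Brzozowski–Simon / McNaughton / Zalcstein: a language of nonempty words is
locally testable iff its syntactic semigroup is finite and `eS(L)e` is
commutative and idempotent for every idempotent `e ∈ S(L)`. -/
theorem locally_testable_iff_syntactic_semigroup
    {A : Type*} [Fintype A] (L : Set (List A)) (hL : ∀ w ∈ L, w ≠ []) :
    LocallyTestable L ↔
      (Finite (SynSemigroup L) ∧
        ∀ e : SynSemigroup L, e * e = e →
          ∀ s t : SynSemigroup L,
            (e * s * e) * (e * s * e) = e * s * e ∧
            (e * s * e) * (e * t * e) = (e * t * e) * (e * s * e)) := by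
  constructor
  · rintro ⟨k, hk, h⟩
    exact ⟨h.finite_synSemigroup hk, fun e he s t => h.locally_semilattice hk he s t⟩
  · rintro ⟨_, hS⟩
    exact ⟨_, Nat.le_add_left 1 _,
      (locallySemilattice_shift hS (Nat.lt_succ_self _)).kTestable (Nat.succ_pos _)⟩
end

section
/- A finite semigroup S is piecewise testable (i.e., J-trivial) if and only if S is aperiodic and for all x, y ∈ S and every n ≥ 1 such that (xy)^n is idempotent, one has (xy)^n·x = (xy)^n and y·(xy)^n = (xy)^n. -/
/-- `spow s n = s^(n+1)`: the `(n+1)`-st power of an element of a semigroup. -/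
def spow {S : Type*} [Semigroup S] (s : S) : ℕ → S
  | 0 => s
  | n + 1 => spow s n * s

/-- A monoid is `J`-trivial if any two elements generating the same two-sided
ideal coincide. -/
def JTrivial (M : Type*) [Monoid M] : Prop :=
  ∀ x y : M, (∃ a b : M, x = a * y * b) → (∃ c d : M, y = c * x * d) → x = y

theorem coe_spow {S : Type*} [Semigroup S] (s : S) (n : ℕ) :
    ((spow s n : S) : WithOne S) = (s : WithOne S) ^ (n + 1) := by
  induction n with
  | zero => simp [spow]
  | succ n ih => rw [spow, WithOne.coe_mul, ih, ← pow_succ]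

theorem pow_mul_eq_of_pow_mul_self {M : Type*} [Monoid M] {s : M} {m : ℕ}
    (h : s ^ m * s = s ^ m) (k : ℕ) : s ^ m * s ^ k = s ^ m := by
  induction k with
  | zero => simp
  | succ k ih => rw [pow_succ, ← mul_assoc, ih, h]

/-- In a `J`-trivial monoid, `u` is fixed by right multiplication by `a` as soon as `u * a`
divides `u` on the left. -/
theorem JTrivial.mul_right_eq {M : Type*} [Monoid M] (hM : JTrivial M) {u a b : M}
    (h : u * a * b = u) : u * a = u :=
  hM _ _ ⟨1, a, by simp⟩ ⟨1, b, by simp [h]⟩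

theorem JTrivial.mul_left_eq {M : Type*} [Monoid M] (hM : JTrivial M) {u a b : M}
    (h : b * (a * u) = u) : a * u = u :=
  hM _ _ ⟨a, 1, by simp⟩ ⟨b, 1, by simp [h]⟩

theorem JTrivial.exists_pow_mul_self {M : Type*} [Monoid M] [Finite M] (hM : JTrivial M)
    (s : M) : ∃ n : ℕ, s ^ (n + 1) * s = s ^ (n + 1) := by
  obtain ⟨i, j, hij, h⟩ : ∃ i j : ℕ, i < j ∧ s ^ (i + 1) = s ^ (j + 1) := by
    obtain ⟨i, j, hne, h⟩ := Finite.exists_ne_map_eq_of_infinite fun n : ℕ => s ^ (n + 1)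
    rcases lt_or_gt_of_ne hne with hlt | hlt
    · exact ⟨i, j, hlt, h⟩
    · exact ⟨j, i, hlt, h.symm⟩
  obtain ⟨k, rfl⟩ := Nat.exists_eq_add_of_lt hij
  refine ⟨i, hM.mul_right_eq (b := s ^ k) ?_⟩
  rw [← pow_succ, ← pow_add, h]
  congr 1
  omega

/-- A monoid in which suitable powers of `x * y` absorb `x` on the right and `y` on the left
is `J`-trivial. -/
theorem jTrivial_of_exists_pow_absorbs {M : Type*} [Monoid M]
    (h : ∀ x y : M, ∃ n : ℕ, (x * y) ^ n * x = (x * y) ^ n ∧ y * (x * y) ^ n = (x * y) ^ n) :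
    JTrivial M := by
  rintro x y ⟨a, b, hx⟩ ⟨c, d, hy⟩
  have key : ∀ n : ℕ, (a * c) ^ n * x * (d * b) ^ n = x := by
    intro n
    induction n with
    | zero => simp
    | succ n ih =>
      have hstep : a * c * x * (d * b) = x := by
        conv_rhs => rw [hx, hy]
        simp only [mul_assoc]
      calc (a * c) ^ (n + 1) * x * (d * b) ^ (n + 1)
          = (a * c) ^ n * (a * c * x * (d * b)) * (d * b) ^ n := by
            rw [pow_succ, pow_succ']
            simp only [mul_assoc]
        _ = x := by rw [hstep, ih]
  have hc : c * x = x := by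
    obtain ⟨n, -, hn⟩ := h a c
    rw [← key n, ← mul_assoc, ← mul_assoc, hn]
  have hd : x * d = x := by
    obtain ⟨n, hn, -⟩ := h d b
    rw [← key n, mul_assoc, hn]
  rw [hy, hc, hd]

/-- Simon: a finite semigroup `S` is piecewise testable (i.e. the monoid `S¹`
obtained by adjoining an identity is `J`-trivial) iff `S` is aperiodic and
whenever a power `(xy)^n` (`n ≥ 1`) is idempotent, `(xy)^n x = (xy)^n`
and `y (xy)^n = (xy)^n`. -/
theorem jtrivial_iff_aperiodic_and_idempotent_power_absorbs
    {S : Type*} [Semigroup S] [Finite S] :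
    JTrivial (WithOne S) ↔
      ((∀ s : S, ∃ n : ℕ, spow s n = spow s n * s) ∧
        ∀ x y : S, ∀ n : ℕ,
          spow (x * y) n * spow (x * y) n = spow (x * y) n →
            spow (x * y) n * x = spow (x * y) n ∧
            y * spow (x * y) n = spow (x * y) n) := by
  constructor
  · intro hM
    have : Finite (WithOne S) := inferInstanceAs (Finite (Option S))
    refine ⟨fun s => ?_, fun x y n he => ?_⟩
    · obtain ⟨n, hn⟩ := hM.exists_pow_mul_self (s : WithOne S)
      refine ⟨n, WithOne.coe_injective ?_⟩
      rw [WithOne.coe_mul, coe_spow, hn]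
    · have he' := congrArg ((↑) : S → WithOne S) he
      simp only [WithOne.coe_mul, coe_spow] at he'
      constructor <;> apply WithOne.coe_injective <;>
        simp only [WithOne.coe_mul, coe_spow]
      · refine hM.mul_right_eq (b := y * ((x : WithOne S) * y) ^ n) ?_
        rw [mul_assoc, ← mul_assoc (x : WithOne S), ← pow_succ', he']
      · refine hM.mul_left_eq (b := ((x : WithOne S) * y) ^ n * x) ?_
        rw [← mul_assoc, mul_assoc _ (x : WithOne S), ← pow_succ, he']
  · rintro ⟨hap, habs⟩
    have hap' : ∀ s : S, ∃ n : ℕ, (s : WithOne S) ^ (n + 1) * s = (s : WithOne S) ^ (n + 1) := by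
      intro s
      obtain ⟨n, hn⟩ := hap s
      refine ⟨n, ?_⟩
      rw [← coe_spow, ← WithOne.coe_mul, ← hn]
    refine jTrivial_of_exists_pow_absorbs fun x y => ?_
    cases x with
    | one =>
      cases y with
      | one => exact ⟨0, by simp⟩
      | coe y =>
        obtain ⟨n, hn⟩ := hap' y
        exact ⟨n + 1, by simp, by rw [one_mul, ← pow_succ', pow_succ, hn]⟩
    | coe x =>
      cases y with
      | one =>
        obtain ⟨n, hn⟩ := hap' x
        exact ⟨n + 1, by rw [mul_one, hn], by simp⟩
      | coe y =>
        obtain ⟨n, hn⟩ := hap' (x * y)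
        have he : spow (x * y) n * spow (x * y) n = spow (x * y) n := by
          apply WithOne.coe_injective
          rw [WithOne.coe_mul, coe_spow, pow_mul_eq_of_pow_mul_self hn]
        obtain ⟨hx, hy⟩ := habs x y n he
        refine ⟨n + 1, ?_⟩
        rw [← WithOne.coe_mul, ← coe_spow, ← WithOne.coe_mul, ← WithOne.coe_mul, hx, hy]
        exact ⟨rfl, rfl⟩
end
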